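/- Comparison of decay exponents: let D_i(z) = c_i z − d z² − a with c₁ < c₂, d ≥ 0, a < 0, 0 < b < −a, and let N(z) = ∫J(s)e^{−zs}ds with J as usual (even, so N is even and convex, N(0)=1). Suppose ρ₁, ρ₂ < 0 satisfy b·N(ρ_i) = D_i(ρ_i) for i = 1,2, each being the unique negative root. Then ρ₁ < ρ₂. -/

import Mathlib

open MeasureTheory Real

theorem negative_root_monotone_in_speed (J : ℝ → ℝ)
    (hJc : Continuous J) (hJeven : ∀ s, J (-s) = J s) (hJnonneg : ∀ s, 0 ≤ J s)
    (hJint : (∫ s : ℝ, J s) = 1)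
    (hJmom : ∀ ρ : ℝ, Integrable (fun s => J s * Real.exp (ρ * s)))
    (hJsupp : ∃ x y : ℝ, x < y ∧ ∀ s ∈ Set.Ioo x y, 0 < J s)
    (d a b c₁ c₂ : ℝ) (hd : 0 ≤ d) (ha : a < 0) (hb : 0 < b) (hba : b < -a)
    (hc : c₁ < c₂) (ρ₁ ρ₂ : ℝ) (hρ₁ : ρ₁ < 0) (hρ₂ : ρ₂ < 0)
    (hroot₁ : b * (∫ s : ℝ, J s * Real.exp (-ρ₁ * s)) = c₁ * ρ₁ - d * ρ₁^2 - a)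
    (hroot₂ : b * (∫ s : ℝ, J s * Real.exp (-ρ₂ * s)) = c₂ * ρ₂ - d * ρ₂^2 - a)
    (huniq₁ : ∀ z : ℝ, z < 0 →
      b * (∫ s : ℝ, J s * Real.exp (-z * s)) = c₁ * z - d * z^2 - a → z = ρ₁)
    (huniq₂ : ∀ z : ℝ, z < 0 →
      b * (∫ s : ℝ, J s * Real.exp (-z * s)) = c₂ * z - d * z^2 - a → z = ρ₂) :
    ρ₁ < ρ₂ := by
  by_contra hcon
  have hle : ρ₂ ≤ ρ₁ := not_lt.mp hcon
  obtain ⟨t, ht⟩ : ∃ t, t = ρ₁ / ρ₂ := ⟨_, rfl⟩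
  have hr : ρ₁ = t * ρ₂ := by rw [ht, div_mul_cancel₀ _ hρ₂.ne]
  have ht0 : 0 < t := by rw [ht]; exact div_pos_of_neg_of_neg hρ₁ hρ₂
  have ht1 : t ≤ 1 := by rw [ht]; exact (div_le_one_of_neg hρ₂).2 hle
  have hJi : Integrable J := by simpa using hJmom 0
  have hN : (∫ s : ℝ, J s * Real.exp (-ρ₁ * s)) ≤
      t * (∫ s : ℝ, J s * Real.exp (-ρ₂ * s)) + (1 - t) * (∫ s : ℝ, J s) := by
    rw [← integral_const_mul, ← integral_const_mul,
      ← integral_add ((hJmom (-ρ₂)).const_mul t) (hJi.const_mul (1 - t))]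
    refine integral_mono (hJmom (-ρ₁))
      (((hJmom (-ρ₂)).const_mul t).add (hJi.const_mul (1 - t))) ?_
    intro s
    have h := convexOn_exp.2 (Set.mem_univ (-ρ₂ * s)) (Set.mem_univ 0) ht0.le
      (sub_nonneg.2 ht1) (by ring)
    simp only [smul_eq_mul, mul_zero, add_zero, Real.exp_zero, mul_one] at h
    have e : -ρ₁ * s = t * (-ρ₂ * s) := by rw [hr]; ring
    have h2 := mul_le_mul_of_nonneg_left h (hJnonneg s)
    simp only [e]
    linarith
  rw [hJint] at hN
  have h1 := mul_le_mul_of_nonneg_left hN hb.le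
  have h3 : 0 < (c₁ - c₂) * ρ₁ := mul_pos_of_neg_of_neg (by linarith) hρ₁
  have h4 : 0 ≤ d * ρ₂ ^ 2 * (t * (1 - t)) :=
    mul_nonneg (mul_nonneg hd (sq_nonneg _)) (mul_nonneg ht0.le (by linarith))
  have h5 : 0 ≤ (-a - b) * (1 - t) := mul_nonneg (by linarith) (by linarith)
  have h6 : b * (t * (∫ s : ℝ, J s * Real.exp (-ρ₂ * s)) + (1 - t) * 1)
      = t * (c₂ * ρ₂ - d * ρ₂^2 - a) + b * (1 - t) := by rw [← hroot₂]; ring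
  rw [h6, hroot₁] at h1
  rw [hr] at h1 h3
  nlinarith
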